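/- Let X be a complex Hilbert space, let b₀ be a bounded Hermitian sesquilinear form on X with Re(b₀(u,u)) ≥ c₀·‖u‖² for all u ∈ X for some constant c₀ > 0, let m be a bounded Hermitian sesquilinear form on X with Re(m(u,u)) ≥ 0 for all u ∈ X, let ε ∈ ℂ satisfy Im(ε) > 0, let k₀ > 0 be real, and let L : X → ℂ be a continuous conjugate-linear functional. Then there exists a unique u ∈ X such that b₀(u, v) − ε·k₀²·m(u, v) = L(v) for every v ∈ X. -/

import Mathlib

open scoped ComplexConjugate in
/-- The Lax–Milgram theorem for sesquilinear forms on a complex Hilbert space. -/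
theorem existsUnique_of_sesqForm_coercive {X : Type*} [NormedAddCommGroup X]
    [InnerProductSpace ℂ X] [CompleteSpace X] (B : X →ₗ[ℂ] X →ₛₗ[starRingEnd ℂ] ℂ)
    {M : ℝ} (hM : ∀ u v : X, ‖B u v‖ ≤ M * ‖u‖ * ‖v‖)
    {c : ℝ} (hc : 0 < c) (hB : ∀ u : X, c * ‖u‖ ^ 2 ≤ ‖B u u‖)
    (L : X →SL[starRingEnd ℂ] ℂ) : ∃! u : X, ∀ v : X, B u v = L v := by
  let C : X →L⋆[ℂ] X →L[ℂ] ℂ :=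
    (LinearMap.mk₂'ₛₗ (starRingEnd ℂ) (RingHom.id ℂ) (fun u v => conj (B u v))
      (by simp) (by simp) (by simp) (by simp)).mkContinuous₂ M (by simpa using hM)
  let T : X →L[ℂ] X := InnerProductSpace.continuousLinearMapOfBilin C
  have hT (u v : X) : inner ℂ (T u) v = conj (B u v) :=
    InnerProductSpace.continuousLinearMapOfBilin_apply C u v
  have hT_unit : IsUnit T := by
    refine ContinuousLinearMap.isUnit_of_forall_le_norm_inner_map T (c := ⟨c, hc.le⟩) hc fun u => ?_
    rw [hT, RCLike.norm_conj, mul_comm]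
    exact hB u
  have hT_bij : Function.Bijective T := ContinuousLinearMap.isUnit_iff_bijective.mp hT_unit
  let l : StrongDual ℂ X :=
    { toFun := fun v => conj (L v)
      map_add' := by simp
      map_smul' := by simp
      cont := by fun_prop }
  have key (u : X) : (∀ v, B u v = L v) ↔ T u = (InnerProductSpace.toDual ℂ X).symm l := by
    refine ⟨fun h => ext_inner_right ℂ fun v => ?_, fun h v => ?_⟩
    · rw [hT, InnerProductSpace.toDual_symm_apply, h v]
      rfl
    · apply (starRingEnd ℂ).injective
      rw [← hT, h, InnerProductSpace.toDual_symm_apply]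
      rfl
  simp only [key]
  exact hT_bij.existsUnique _

/-- If `Im ε > 0`, then `a - ε t` is bounded below by a fixed multiple of `a`, uniformly in
`t ≥ 0`. -/
theorem Complex.exists_pos_mul_le_norm_sub_mul {ε : ℂ} (hε : 0 < ε.im) :
    ∃ δ : ℝ, 0 < δ ∧ ∀ a t : ℝ, 0 ≤ t → δ * a ≤ ‖(a : ℂ) - ε * t‖ := by
  let β : ℝ := |ε.re| / ε.im
  have hβ : ε.re ≤ β * ε.im := by
    rw [div_mul_cancel₀ _ hε.ne']
    exact le_abs_self _
  let ζ : ℂ := ⟨1, β⟩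
  have hζ : 0 < ‖ζ‖ := norm_pos_iff.mpr fun h => one_ne_zero (congrArg Complex.re h)
  refine ⟨‖ζ‖⁻¹, inv_pos.mpr hζ, fun a t ht => ?_⟩
  rw [inv_mul_le_iff₀ hζ, ← norm_mul]
  refine le_trans ?_ (Complex.re_le_norm _)
  have : (ζ * ((a : ℂ) - ε * t)).re = a + (β * ε.im - ε.re) * t := by
    simp [ζ]
    ring
  rw [this]
  linarith [mul_nonneg (sub_nonneg.mpr hβ) ht]

/-- Lax–Milgram with complex multiplier: if `b₀` is a bounded Hermitian coercive
sesquilinear form, `m` a bounded Hermitian nonnegative sesquilinear form, `Im ε > 0`,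
`k₀ > 0`, and `L` a continuous conjugate-linear functional, then the equation
`b₀(u,v) − ε k₀² m(u,v) = L(v)` (for all `v`) has a unique solution `u`. -/
theorem stmt6 {X : Type*} [NormedAddCommGroup X] [InnerProductSpace ℂ X] [CompleteSpace X]
    (b₀ m : X →ₗ[ℂ] X →ₛₗ[starRingEnd ℂ] ℂ)
    (hb₀_bdd : ∃ M : ℝ, ∀ u v : X, ‖b₀ u v‖ ≤ M * ‖u‖ * ‖v‖)
    (hb₀_herm : ∀ u v : X, b₀ v u = starRingEnd ℂ (b₀ u v))
    (c₀ : ℝ) (hc₀ : 0 < c₀)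
    (hb₀_coer : ∀ u : X, c₀ * ‖u‖ ^ 2 ≤ (b₀ u u).re)
    (hm_bdd : ∃ M : ℝ, ∀ u v : X, ‖m u v‖ ≤ M * ‖u‖ * ‖v‖)
    (hm_herm : ∀ u v : X, m v u = starRingEnd ℂ (m u v))
    (hm_nonneg : ∀ u : X, 0 ≤ (m u u).re)
    (ε : ℂ) (hε : 0 < ε.im) (k₀ : ℝ) (hk₀ : 0 < k₀)
    (L : X →SL[starRingEnd ℂ] ℂ) :
    ∃! u : X, ∀ v : X, b₀ u v - ε * (k₀ : ℂ) ^ 2 * m u v = L v := by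
  obtain ⟨M₁, hM₁⟩ := hb₀_bdd
  obtain ⟨M₂, hM₂⟩ := hm_bdd
  obtain ⟨δ, hδ, hδ_le⟩ := Complex.exists_pos_mul_le_norm_sub_mul hε
  refine existsUnique_of_sesqForm_coercive (b₀ - (ε * (k₀ : ℂ) ^ 2) • m)
    (M := M₁ + ‖ε * (k₀ : ℂ) ^ 2‖ * M₂) (fun u v => ?_) (mul_pos hδ hc₀) (fun u => ?_) L
  · calc ‖b₀ u v - ε * (k₀ : ℂ) ^ 2 * m u v‖
        ≤ ‖b₀ u v‖ + ‖ε * (k₀ : ℂ) ^ 2‖ * ‖m u v‖ := by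
          rw [← norm_mul]
          exact norm_sub_le _ _
      _ ≤ M₁ * ‖u‖ * ‖v‖ + ‖ε * (k₀ : ℂ) ^ 2‖ * (M₂ * ‖u‖ * ‖v‖) := by
          gcongr
          exacts [hM₁ u v, hM₂ u v]
      _ = (M₁ + ‖ε * (k₀ : ℂ) ^ 2‖ * M₂) * ‖u‖ * ‖v‖ := by ring
  · have hb : ((b₀ u u).re : ℂ) = b₀ u u := Complex.conj_eq_iff_re.mp (hb₀_herm u u).symm
    have hm : ((m u u).re : ℂ) = m u u := Complex.conj_eq_iff_re.mp (hm_herm u u).symm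
    calc δ * c₀ * ‖u‖ ^ 2 ≤ δ * (b₀ u u).re := by
          rw [mul_assoc]
          exact mul_le_mul_of_nonneg_left (hb₀_coer u) hδ.le
      _ ≤ ‖((b₀ u u).re : ℂ) - ε * (k₀ ^ 2 * (m u u).re : ℝ)‖ :=
          hδ_le _ _ (mul_nonneg (sq_nonneg k₀) (hm_nonneg u))
      _ = ‖b₀ u u - ε * (k₀ : ℂ) ^ 2 * m u u‖ := by
          push_cast
          rw [hb, hm, mul_assoc]
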